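/- Let 0 < s < t and let γ_r denote the Gaussian probability measure on ℝ with mean 0 and variance r². If μ and ν are probability measures on ℝ with μ ≠ ν and KL(μ ∗ γ_s ‖ ν ∗ γ_s) < ∞, then KL(μ ∗ γ_t ‖ ν ∗ γ_t) < KL(μ ∗ γ_s ‖ ν ∗ γ_s). (Strict monotonicity of the KL divergence in the noise level, the strict form of the second part of the paper's Theorem 1: higher σ_t² yields strictly smaller divergence.) -/

import Mathlib

open MeasureTheory ProbabilityTheory

/- Kullback–Leibler divergence: `∫ log (dμ/dν) dμ` if `μ ≪ ν` (and the log-likelihood ratio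
is integrable), and `+∞` otherwise. -/
open scoped Classical in
noncomputable def klDiv {α : Type*} [MeasurableSpace α] (μ ν : Measure α) : EReal :=
  if μ ≪ ν ∧ Integrable (llr μ ν) μ then ((∫ x, llr μ ν x ∂μ : ℝ) : EReal) else ⊤

/-- For probability measures, `klDiv` agrees with the divergence of Mathlib. -/
lemma klDiv_eq_coe_klDiv {α : Type*} [MeasurableSpace α] (μ ν : Measure α)
    [IsProbabilityMeasure μ] [IsProbabilityMeasure ν] :
    klDiv μ ν = (InformationTheory.klDiv μ ν : EReal) := by
  by_cases h : μ ≪ ν ∧ Integrable (llr μ ν) μ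
  · rw [klDiv, if_pos h, ← InformationTheory.toReal_klDiv_of_measure_eq h.1 (by simp),
      EReal.coe_ennreal_toReal (InformationTheory.klDiv_ne_top h.1 h.2)]
  · have : InformationTheory.klDiv μ ν = ⊤ :=
      InformationTheory.klDiv_eq_top_iff.2 fun h1 h2 => h ⟨h1, h2⟩
    rw [klDiv, if_neg h, this, EReal.coe_ennreal_top]

/-- If projecting to the first coordinate does not decrease a finite Kullback–Leibler divergence,
then the density only depends on the first coordinate. -/
lemma rnDeriv_ae_eq_of_klDiv_le_klDiv_fst {α β : Type*} [MeasurableSpace α] [MeasurableSpace β]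
    [StandardBorelSpace β] [Nonempty β] (M N : Measure (α × β))
    [IsFiniteMeasure M] [IsFiniteMeasure N]
    (hfin : InformationTheory.klDiv M N ≠ ⊤)
    (hle : InformationTheory.klDiv M N ≤ InformationTheory.klDiv M.fst N.fst) :
    ∀ᵐ p ∂N, M.rnDeriv N p = M.fst.rnDeriv N.fst p.1 := by
  have hchain := InformationTheory.klDiv_compProd_eq_add M.fst N.fst M.condKernel N.condKernel
  rw [M.disintegrate, N.disintegrate] at hchain
  have hzero : InformationTheory.klDiv M (M.fst ⊗ₘ N.condKernel) = 0 := by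
    have hne : InformationTheory.klDiv M.fst N.fst ≠ ⊤ := by
      intro h
      rw [h, top_add] at hchain
      exact hfin hchain
    rw [hchain] at hle
    by_contra h
    exact (ENNReal.lt_add_right hne h).not_ge hle
  have hM : M = M.fst ⊗ₘ N.condKernel := InformationTheory.klDiv_eq_zero_iff.1 hzero
  have h := ProbabilityTheory.rnDeriv_measure_compProd_left M.fst N.fst N.condKernel
  rwa [← hM, N.disintegrate] at h

lemma eq_of_rnDeriv_ae_eq_const {α : Type*} [MeasurableSpace α] (μ ν : Measure α)
    [IsProbabilityMeasure μ] [IsProbabilityMeasure ν] (hμν : μ ≪ ν) (c : ENNReal)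
    (h : ∀ᵐ x ∂ν, μ.rnDeriv ν x = c) : μ = ν := by
  have hμ : μ = c • ν := by
    rw [← Measure.withDensity_rnDeriv_eq μ ν hμν, withDensity_congr_ae h, withDensity_const]
  have hc : c = 1 := by
    have := congrArg (fun m => m Set.univ) hμ
    simpa using this.symm
  rw [hμ, hc, one_smul]

/-- A function of `x` which almost everywhere agrees with a function of `x + y` is constant. -/
lemma exists_ae_eq_const_of_ae_eq_comp_add {β : Type*} {f h : ℝ → β}
    (hfh : ∀ᵐ p : ℝ × ℝ, f p.1 = h (p.1 + p.2)) : ∃ c, ∀ᵐ x, f x = c := by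
  have h1 : ∀ᵐ x : ℝ, ∀ᵐ z : ℝ, f x = h z := by
    filter_upwards [Measure.ae_ae_of_ae_prod hfh] with x hx
    have := (measurePreserving_add_left (volume : Measure ℝ) (-x)).quasiMeasurePreserving.ae hx
    simpa using this
  obtain ⟨x₀, hx₀⟩ := h1.exists
  refine ⟨f x₀, ?_⟩
  filter_upwards [h1] with x hx
  obtain ⟨z, hz, hz₀⟩ := (hx.and hx₀).exists
  exact hz.trans hz₀.symm

/-- Convolving with a probability measure equivalent to Lebesgue measure strictly decreases a
finite Kullback–Leibler divergence. -/
lemma klDiv_conv_lt (P Q G : Measure ℝ) [IsProbabilityMeasure P] [IsProbabilityMeasure Q]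
    [IsProbabilityMeasure G] (hPQ : P ≠ Q) (hQ : Q ≪ volume) (hQ' : volume ≪ Q)
    (hG : volume ≪ G) (hfin : InformationTheory.klDiv P Q ≠ ⊤) :
    InformationTheory.klDiv (P.conv G) (Q.conv G) < InformationTheory.klDiv P Q := by
  by_contra! hle
  let e : ℝ × ℝ ≃ᵐ ℝ × ℝ := (MeasurableEquiv.shearAddRight ℝ).trans MeasurableEquiv.prodComm
  have he (p : ℝ × ℝ) : e p = (p.1 + p.2, p.1) := rfl
  have hfst (R : Measure ℝ) : ((R.prod G).map e).fst = R.conv G := by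
    rw [Measure.fst, Measure.map_map measurable_fst e.measurable]
    rfl
  have hmap : InformationTheory.klDiv ((P.prod G).map e) ((Q.prod G).map e)
      ≤ InformationTheory.klDiv P Q := by
    refine (InformationTheory.klDiv_map_le _ _ e.measurable).trans_eq ?_
    rw [← Measure.compProd_const, ← Measure.compProd_const, InformationTheory.klDiv_compProd_left]
  have hac : P ≪ Q := (InformationTheory.klDiv_ne_top_iff.1 hfin).1
  have hMN := rnDeriv_ae_eq_of_klDiv_le_klDiv_fst ((P.prod G).map e) ((Q.prod G).map e)
    (ne_top_of_le_ne_top hfin hmap) (by rw [hfst, hfst]; exact hmap.trans hle)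
  rw [hfst, hfst] at hMN
  have hdens : ∀ᵐ p ∂(Q.prod G), P.rnDeriv Q p.1 = (P.conv G).rnDeriv (Q.conv G) (p.1 + p.2) := by
    have h1 := ae_of_ae_map e.measurable.aemeasurable hMN
    have h2 := e.measurableEmbedding.rnDeriv_map (P.prod G) (Q.prod G)
    have h3 := ProbabilityTheory.rnDeriv_measure_compProd_left P Q (Kernel.const ℝ G)
    rw [Measure.compProd_const, Measure.compProd_const] at h3
    filter_upwards [h1, h2, h3] with p hp1 hp2 hp3
    rw [← hp3, ← hp2, hp1, he]
  obtain ⟨c, hc⟩ := exists_ae_eq_const_of_ae_eq_comp_add ((hQ'.prod hG).ae_le hdens)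
  exact hPQ (eq_of_rnDeriv_ae_eq_const P Q hac c (hQ.ae_le hc))

lemma volume_absolutelyContinuous_conv (ν G : Measure ℝ) [NeZero ν] [SFinite ν] [SFinite G]
    (hG : volume ≪ G) : volume ≪ ν.conv G := by
  refine Measure.AbsolutelyContinuous.mk fun A hA h => ?_
  rw [Measure.conv, Measure.map_apply (by fun_prop) hA] at h
  obtain ⟨x, hx⟩ := (Measure.ae_ae_of_ae_prod (measure_eq_zero_iff_ae_notMem.1 h)).exists
  have hx' : volume ((fun y => x + y) ⁻¹' A) = 0 :=
    hG (measure_eq_zero_iff_ae_notMem.2 hx)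
  rwa [measure_preimage_add] at hx'

lemma conv_gaussianReal_injective (v : NNReal) (μ ν : Measure ℝ)
    [IsFiniteMeasure μ] [IsFiniteMeasure ν]
    (h : μ.conv (gaussianReal 0 v) = ν.conv (gaussianReal 0 v)) : μ = ν := by
  refine Measure.ext_of_charFun (funext fun t => ?_)
  have ht := congrArg (fun m => charFun m t) h
  simp only [charFun_conv] at ht
  refine mul_right_cancel₀ ?_ ht
  rw [charFun_gaussianReal]
  exact Complex.exp_ne_zero _

/-- Strict monotonicity of the Kullback–Leibler divergence in the Gaussian noise level:
for noise levels 0 < s < t, if μ ≠ ν and the divergence of the laws noised at level s is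
finite, then noising at level t gives a strictly smaller KL divergence. -/
theorem klDiv_conv_gaussian_strictAnti (s t : ℝ) (hs : 0 < s) (hst : s < t)
    (μ ν : Measure ℝ) [IsProbabilityMeasure μ] [IsProbabilityMeasure ν] (hμν : μ ≠ ν)
    (hfin : klDiv (μ.conv (gaussianReal 0 ⟨s ^ 2, sq_nonneg s⟩))
        (ν.conv (gaussianReal 0 ⟨s ^ 2, sq_nonneg s⟩)) < ⊤) :
    klDiv (μ.conv (gaussianReal 0 ⟨t ^ 2, sq_nonneg t⟩))
        (ν.conv (gaussianReal 0 ⟨t ^ 2, sq_nonneg t⟩)) <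
      klDiv (μ.conv (gaussianReal 0 ⟨s ^ 2, sq_nonneg s⟩))
        (ν.conv (gaussianReal 0 ⟨s ^ 2, sq_nonneg s⟩)) := by
  set vs : NNReal := ⟨s ^ 2, sq_nonneg s⟩ with hvs
  set vt : NNReal := ⟨t ^ 2, sq_nonneg t⟩ with hvt
  have hs0 : vs ≠ 0 := (show 0 < vs from pow_pos hs 2).ne'
  have hlt : vs < vt := show s ^ 2 < t ^ 2 by gcongr
  have hd0 : vt - vs ≠ 0 := (tsub_pos_of_lt hlt).ne'
  have hconv (ρ : Measure ℝ) [IsProbabilityMeasure ρ] : ρ.conv (gaussianReal 0 vt) =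
      (ρ.conv (gaussianReal 0 vs)).conv (gaussianReal 0 (vt - vs)) := by
    rw [Measure.conv_assoc, gaussianReal_conv_gaussianReal, add_zero, add_tsub_cancel_of_le hlt.le]
  rw [hconv μ, hconv ν, klDiv_eq_coe_klDiv, klDiv_eq_coe_klDiv, EReal.coe_ennreal_lt_coe_ennreal_iff]
  rw [klDiv_eq_coe_klDiv] at hfin
  exact klDiv_conv_lt _ _ _ (fun h => hμν (conv_gaussianReal_injective vs μ ν h))
    (Measure.conv_absolutelyContinuous (gaussianReal_absolutelyContinuous 0 hs0))
    (volume_absolutelyContinuous_conv ν _ (gaussianReal_absolutelyContinuous' 0 hs0))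
    (gaussianReal_absolutelyContinuous' 0 hd0)
    (fun h => by simp [h] at hfin)
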